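/- arXiv:2004.14282 — 3 statements merged into one kernel-verified Lean document; each statement's English description precedes it below -/
import Mathlib

section
/- Let ρ be a probability measure on ℝ with finite moments m_n = ∫ x^n dρ(x) of all orders n ≥ 0. If the power series ∑_{n≥0} m_n x^n / n! has a positive radius of convergence, then ρ is determined by its moments: any probability measure ρ' on ℝ with ∫ x^n dρ'(x) = m_n for all n ≥ 0 satisfies ρ' = ρ. -/
open MeasureTheory

/-- The hyperbolic cosine is integrable when the even moment series converges. -/
lemma aux_cosh_integrable (ρ : Measure ℝ)
    (hint : ∀ n : ℕ, Integrable (fun x => |x| ^ n) ρ) (r : ℝ) (hr : 0 < r)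
    (hs : Summable (fun n : ℕ => |∫ x, x ^ n ∂ρ| * r ^ n / n.factorial)) :
    Integrable (fun x => Real.cosh (r * x)) ρ := by
  have hpos : ∀ (n : ℕ) (x : ℝ), 0 ≤ (r * x) ^ (2 * n) / ((2 * n).factorial : ℝ) := by
    intro n x
    rw [pow_mul]
    positivity
  have hI : ∀ n : ℕ, Integrable (fun x : ℝ => (r * x) ^ (2 * n) / ((2 * n).factorial : ℝ)) ρ := by
    intro n
    have h := ((hint (2 * n)).const_mul (r ^ (2 * n))).div_const ((2 * n).factorial : ℝ)
    refine h.congr (Filter.Eventually.of_forall fun x => ?_)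
    simp only [mul_pow, (even_two_mul n).pow_abs]
  have hval : ∀ n : ℕ, ∫ x, (r * x) ^ (2 * n) / ((2 * n).factorial : ℝ) ∂ρ
      = |∫ x, x ^ (2 * n) ∂ρ| * r ^ (2 * n) / ((2 * n).factorial : ℝ) := by
    intro n
    have h0 : 0 ≤ ∫ x, x ^ (2 * n) ∂ρ :=
      integral_nonneg fun x => (even_two_mul n).pow_nonneg x
    rw [abs_of_nonneg h0, integral_div]
    simp only [mul_pow]
    rw [integral_const_mul, mul_comm]
  have hs2 : Summable (fun n : ℕ => ∫ x, (r * x) ^ (2 * n) / ((2 * n).factorial : ℝ) ∂ρ) := by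
    simp only [hval]
    exact hs.comp_injective (i := fun n : ℕ => 2 * n)
      (fun a b h => by simpa using h)
  refine ⟨by fun_prop, ?_⟩
  rw [hasFiniteIntegral_iff_ofReal (Filter.Eventually.of_forall fun x => (Real.cosh_pos _).le)]
  have : ∀ x : ℝ, ENNReal.ofReal (Real.cosh (r * x))
      = ∑' n : ℕ, ENNReal.ofReal ((r * x) ^ (2 * n) / ((2 * n).factorial : ℝ)) := by
    intro x
    rw [Real.cosh_eq_tsum, ENNReal.ofReal_tsum_of_nonneg (fun n => hpos n x)
      (Real.hasSum_cosh (r * x)).summable]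
  simp only [this]
  rw [lintegral_tsum (fun n => by fun_prop)]
  have h2 : ∀ n : ℕ, ∫⁻ x, ENNReal.ofReal ((r * x) ^ (2 * n) / ((2 * n).factorial : ℝ)) ∂ρ
      = ENNReal.ofReal (∫ x, (r * x) ^ (2 * n) / ((2 * n).factorial : ℝ) ∂ρ) := fun n =>
    (ofReal_integral_eq_lintegral_ofReal (hI n) (Filter.Eventually.of_forall (hpos n))).symm
  simp only [h2]
  rw [← ENNReal.ofReal_tsum_of_nonneg (fun n => integral_nonneg (hpos n)) hs2]
  exact ENNReal.ofReal_lt_top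

lemma aux_subset (ρ : Measure ℝ) (r : ℝ)
    (h : Integrable (fun x => Real.cosh (r * x)) ρ) :
    Set.Ioo (-r) r ⊆ interior (ProbabilityTheory.integrableExpSet id ρ) := by
  refine interior_maximal ?_ isOpen_Ioo
  intro t ht
  show Integrable (fun x : ℝ => Real.exp (t * id x)) ρ
  refine (h.const_mul 2).mono' (by fun_prop) (Filter.Eventually.of_forall fun x => ?_)
  rw [Real.norm_of_nonneg (Real.exp_pos _).le, Real.cosh_eq]
  have h1 := Real.exp_pos (r * x)
  have h2 := Real.exp_pos (-(r * x))
  rcases le_total 0 x with hx | hx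
  · have : Real.exp (t * id x) ≤ Real.exp (r * x) :=
      Real.exp_le_exp.2 (mul_le_mul_of_nonneg_right ht.2.le hx)
    linarith
  · have : Real.exp (t * id x) ≤ Real.exp (-(r * x)) :=
      Real.exp_le_exp.2 (by simp only [id]; nlinarith [ht.1])
    linarith

/-- If the moment generating series `∑ mₙ xⁿ/n!` of a probability measure `ρ` on `ℝ`
has a positive radius of convergence, then `ρ` is determined by its moments. -/
theorem moments_determine_measure
    (ρ : Measure ℝ) [IsProbabilityMeasure ρ]
    (hint : ∀ n : ℕ, Integrable (fun x => |x| ^ n) ρ)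
    (m : ℕ → ℝ) (hm : ∀ n : ℕ, m n = ∫ x, x ^ n ∂ρ)
    (hrad : ∃ r > (0 : ℝ), Summable (fun n : ℕ => |m n| * r ^ n / n.factorial)) :
    ∀ ρ' : Measure ℝ, IsProbabilityMeasure ρ' →
      (∀ n : ℕ, Integrable (fun x => |x| ^ n) ρ') →
      (∀ n : ℕ, ∫ x, x ^ n ∂ρ' = m n) → ρ' = ρ := by
  intro ρ' hp hint' hm'
  obtain ⟨r, hr, hs⟩ := hrad
  have hA := aux_subset ρ r (aux_cosh_integrable ρ hint r hr (by simpa only [← hm] using hs))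
  have hB := aux_subset ρ' r (aux_cosh_integrable ρ' hint' r hr (by simpa only [hm'] using hs))
  have h0 : (0 : ℂ).re ∈ Set.Ioo (-r) r := by simp [hr]
  have hder : ∀ n : ℕ, iteratedDeriv n (ProbabilityTheory.complexMGF id ρ') 0
      = iteratedDeriv n (ProbabilityTheory.complexMGF id ρ) 0 := by
    intro n
    rw [ProbabilityTheory.iteratedDeriv_complexMGF (hA h0),
      ProbabilityTheory.iteratedDeriv_complexMGF (hB h0)]
    have := (hm' n).trans (hm n)
    simp only [zero_mul, Complex.exp_zero, mul_one, id, ← Complex.ofReal_pow]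
    rw [integral_complex_ofReal, integral_complex_ofReal, this]
  have hev : ProbabilityTheory.complexMGF id ρ' =ᶠ[nhds 0] ProbabilityTheory.complexMGF id ρ := by
    have f1 := (ProbabilityTheory.analyticAt_complexMGF (hA h0)).hasFPowerSeriesAt
    have f2 := (ProbabilityTheory.analyticAt_complexMGF (hB h0)).hasFPowerSeriesAt
    simp only [hder] at f2
    filter_upwards [f1.eventually_hasSum_sub, f2.eventually_hasSum_sub] with z h1 h2
    exact h2.unique h1
  have heq : Set.EqOn (ProbabilityTheory.complexMGF id ρ') (ProbabilityTheory.complexMGF id ρ)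
      {z : ℂ | z.re ∈ Set.Ioo (-r) r} := by
    refine AnalyticOnNhd.eqOn_of_preconnected_of_eventuallyEq (𝕜 := ℂ)
      (ProbabilityTheory.analyticOnNhd_complexMGF.mono fun z hz => hB hz)
      (ProbabilityTheory.analyticOnNhd_complexMGF.mono fun z hz => hA hz) ?_ h0 hev
    exact ((convex_Ioo (-r) r).linear_preimage Complex.reLm).isPreconnected
  refine Measure.ext_of_charFun (funext fun t => ?_)
  rw [← ProbabilityTheory.complexMGF_id_mul_I, ← ProbabilityTheory.complexMGF_id_mul_I]
  exact heq (by simp [hr])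
end

section
/- A sequence (m_n)_{n≥0} of real numbers with m₀ = 1 is the moment sequence of some Borel probability measure on ℝ if and only if for every polynomial P = ∑ x_n u^n with P(u) ≥ 0 for all u ∈ ℝ, one has ∑ x_n m_n ≥ 0. -/
open MeasureTheory

open scoped CompactlySupported

/-- Real functions dominated by a polynomial. -/
def polyDom : Submodule ℝ (ℝ → ℝ) where
  carrier := {f | ∃ P : Polynomial ℝ, ∀ u, |f u| ≤ P.eval u}
  zero_mem' := ⟨0, fun u => by simp⟩
  add_mem' := by
    rintro f g ⟨P, hP⟩ ⟨Q, hQ⟩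
    refine ⟨P + Q, fun u => ?_⟩
    rw [Polynomial.eval_add]
    exact (abs_add_le _ _).trans (add_le_add (hP u) (hQ u))
  smul_mem' := by
    rintro c f ⟨P, hP⟩
    refine ⟨Polynomial.C |c| * P, fun u => ?_⟩
    simp only [Pi.smul_apply, smul_eq_mul, abs_mul, Polynomial.eval_mul, Polynomial.eval_C]
    exact mul_le_mul_of_nonneg_left (hP u) (abs_nonneg c)

lemma poly_mem_polyDom (P : Polynomial ℝ) : (fun u => P.eval u) ∈ polyDom := by
  refine ⟨1 + P ^ 2, fun u => ?_⟩
  simp only [Polynomial.eval_add, Polynomial.eval_one, Polynomial.eval_pow]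
  rw [abs_le]
  constructor <;> nlinarith [sq_nonneg (P.eval u + 1), sq_nonneg (P.eval u - 1)]

lemma mem_polyDom_of_le {f g : ℝ → ℝ} (hg : g ∈ polyDom) (h : ∀ u, |f u| ≤ g u) :
    f ∈ polyDom := by
  obtain ⟨P, hP⟩ := hg
  exact ⟨P, fun u => (h u).trans ((le_abs_self _).trans (hP u))⟩

lemma cc_mem_polyDom {f : ℝ → ℝ} (hc : Continuous f) (hs : HasCompactSupport f) :
    f ∈ polyDom := by
  obtain ⟨C, hC⟩ := hs.exists_bound_of_continuous hc
  exact ⟨Polynomial.C C, fun u => by simpa using hC u⟩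

/-- Evaluation of polynomials as a linear map. -/
noncomputable def polyEmb : Polynomial ℝ →ₗ[ℝ] polyDom where
  toFun P := ⟨fun u => P.eval u, poly_mem_polyDom P⟩
  map_add' P Q := by ext u; simp
  map_smul' c P := by ext u; simp

lemma polyEmb_injective : Function.Injective polyEmb := by
  intro P Q h
  apply Polynomial.funext
  intro u
  exact congrFun (congrArg Subtype.val h) u

/-- The moment functional. -/
noncomputable def momL (m : ℕ → ℝ) : Polynomial ℝ →ₗ[ℝ] ℝ where
  toFun P := P.sum (fun n c => c * m n)
  map_add' P Q := Polynomial.sum_add_index P Q _ (by simp) (by intros; ring)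
  map_smul' c P := by
    rw [Polynomial.sum_smul_index' P c _ (by simp), Polynomial.sum_def, Polynomial.sum_def]
    simp [Finset.mul_sum, mul_assoc]

/-- The cone of nonnegative functions. -/
def polyCone : PointedCone ℝ polyDom where
  carrier := {f | ∀ u, 0 ≤ f.1 u}
  zero_mem' := fun u => le_rfl
  add_mem' := fun {f g} hf hg u => add_nonneg (hf u) (hg u)
  smul_mem' := fun c f hf u => mul_nonneg c.2 (hf u)

lemma exists_extension (m : ℕ → ℝ)
    (h : ∀ P : Polynomial ℝ, (∀ u : ℝ, 0 ≤ P.eval u) → 0 ≤ P.sum (fun n c => c * m n)) :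
    ∃ L : polyDom →ₗ[ℝ] ℝ, (∀ P, L (polyEmb P) = momL m P) ∧
      ∀ f : polyDom, (∀ u, 0 ≤ f.1 u) → 0 ≤ L f := by
  let e := LinearEquiv.ofInjective polyEmb polyEmb_injective
  let F : polyDom →ₗ.[ℝ] ℝ := ⟨LinearMap.range polyEmb, (momL m).comp e.symm.toLinearMap⟩
  have hF : ∀ P : Polynomial ℝ, ∀ hP : polyEmb P ∈ F.domain, F ⟨polyEmb P, hP⟩ = momL m P := by
    intro P hP
    change momL m (e.symm ⟨polyEmb P, hP⟩) = _
    congr 1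
    rw [LinearEquiv.symm_apply_eq]
    rfl
  obtain ⟨g, hg, hg0⟩ := riesz_extension polyCone F (by
      rintro ⟨_, ⟨P, rfl⟩⟩ hx
      exact (h P hx).trans_eq (hF P ⟨P, rfl⟩).symm) (by
      rintro ⟨f, ⟨P, hP⟩⟩
      refine ⟨⟨polyEmb P, ⟨P, rfl⟩⟩, fun u => ?_⟩
      change 0 ≤ P.eval u + f u
      linarith [neg_abs_le (f u), hP u])
  refine ⟨g, fun P => ?_, hg0⟩
  rw [← hF P ⟨P, rfl⟩]
  exact hg ⟨polyEmb P, ⟨P, rfl⟩⟩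

lemma exists_measure (L : polyDom →ₗ[ℝ] ℝ) (hL : ∀ f : polyDom, (∀ u, 0 ≤ f.1 u) → 0 ≤ L f) :
    ∃ μ : Measure ℝ, IsFiniteMeasureOnCompacts μ ∧
      ∀ f : polyDom, Continuous f.1 → HasCompactSupport f.1 → ∫ u, f.1 u ∂μ = L f := by
  let ι : C_c(ℝ, ℝ) →ₗ[ℝ] polyDom :=
    { toFun := fun f => ⟨f, cc_mem_polyDom f.continuous f.hasCompactSupport⟩
      map_add' := fun f g => rfl
      map_smul' := fun c f => rfl }
  let Λ : C_c(ℝ, ℝ) →ₚ[ℝ] ℝ := PositiveLinearMap.mk₀ (L.comp ι) (fun f hf => hL _ (fun u => hf u))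
  refine ⟨RealRMK.rieszMeasure Λ, inferInstance, fun f hc hs => ?_⟩
  exact RealRMK.integral_rieszMeasure Λ ⟨⟨f.1, hc⟩, hs⟩

/-- Cutoff function. -/
noncomputable def cutoff (k : ℝ) (u : ℝ) : ℝ := max 0 (min 1 (k + 1 - |u|))

lemma cutoff_cont (k : ℝ) : Continuous (cutoff k) := by unfold cutoff; fun_prop

lemma cutoff_nonneg (k u : ℝ) : 0 ≤ cutoff k u := le_max_left _ _

lemma cutoff_le_one (k u : ℝ) : cutoff k u ≤ 1 := max_le zero_le_one (min_le_left _ _)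

lemma cutoff_eq_one {k u : ℝ} (h : |u| ≤ k) : cutoff k u = 1 := by
  unfold cutoff
  rw [min_eq_left (by linarith), max_eq_right zero_le_one]

lemma cutoff_supp (k : ℝ) : HasCompactSupport (cutoff k) := by
  refine HasCompactSupport.intro (isCompact_Icc (a := -(k+1)) (b := k+1)) fun u hu => ?_
  have : k + 1 < |u| := by
    by_contra hc
    exact hu (abs_le.mp (not_lt.mp hc))
  unfold cutoff
  rw [max_eq_left]
  exact (min_le_right _ _).trans (by linarith)

lemma tail_bound (n : ℕ) {k : ℝ} (hk : 0 < k) (u : ℝ) :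
    |u ^ n - cutoff k u * u ^ n| ≤ k⁻¹ * (1 + u ^ (2 * (n + 1))) := by
  have hpos : 0 ≤ u ^ (2 * (n + 1)) := by rw [pow_mul]; positivity
  rcases le_or_gt |u| k with h | h
  · rw [cutoff_eq_one h]
    simp only [one_mul, sub_self, abs_zero]
    positivity
  · have h1 : |u ^ n - cutoff k u * u ^ n| ≤ |u| ^ n := by
      have : u ^ n - cutoff k u * u ^ n = (1 - cutoff k u) * u ^ n := by ring
      rw [this, abs_mul, abs_pow]
      refine mul_le_of_le_one_left (by positivity) ?_
      rw [abs_le]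
      constructor <;> linarith [cutoff_nonneg k u, cutoff_le_one k u]
    refine h1.trans ?_
    rw [← div_eq_inv_mul, le_div_iff₀ hk]
    have h2 : |u| ^ n * k ≤ |u| ^ (n + 1) := by
      rw [pow_succ]
      exact mul_le_mul_of_nonneg_left h.le (by positivity)
    have h3 : u ^ (2 * (n + 1)) = (|u| ^ (n + 1)) ^ 2 := by
      rw [← abs_pow, sq_abs, mul_comm, pow_mul]
    rw [h3]
    nlinarith [sq_nonneg (|u| ^ (n + 1) - 1), sq_nonneg (|u| ^ (n + 1))]

lemma moments_of_functional (L : polyDom →ₗ[ℝ] ℝ)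
    (hL : ∀ f : polyDom, (∀ u, 0 ≤ f.1 u) → 0 ≤ L f) (μ : Measure ℝ)
    [IsFiniteMeasureOnCompacts μ]
    (hμ : ∀ f : polyDom, Continuous f.1 → HasCompactSupport f.1 → ∫ u, f.1 u ∂μ = L f) (n : ℕ) :
    Integrable (fun u : ℝ => u ^ n) μ ∧ ∫ u, u ^ n ∂μ = L (polyEmb (Polynomial.X ^ n)) := by
  have mono : ∀ f g : polyDom, (∀ u, f.1 u ≤ g.1 u) → L f ≤ L g := by
    intro f g hfg
    have := hL (g - f) (fun u => sub_nonneg.mpr (hfg u))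
    rw [map_sub] at this
    linarith
  have hInteg : ∀ n : ℕ, Integrable (fun u : ℝ => u ^ n) μ := by
    intro n
    let Q : Polynomial ℝ := 1 + (Polynomial.X ^ n) ^ 2
    have hQ : ∀ u, Q.eval u = 1 + (u ^ n) ^ 2 := fun u => by simp [Q]
    refine (aecover_Icc (μ := μ) (l := Filter.atTop) (a := fun k : ℕ => -(k : ℝ))
      (b := fun k : ℕ => (k : ℝ))
      (Filter.tendsto_neg_atTop_atBot.comp tendsto_natCast_atTop_atTop)
      tendsto_natCast_atTop_atTop).integrable_of_integral_norm_bounded (L (polyEmb Q))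
      (fun k => (Continuous.continuousOn (by fun_prop)).integrableOn_Icc)
      (Filter.Eventually.of_forall fun k => ?_)
    have hc : Continuous (fun u => cutoff k u * Q.eval u) :=
      (cutoff_cont k).mul Q.continuous
    have hs : HasCompactSupport (fun u => cutoff k u * Q.eval u) := (cutoff_supp k).mul_right
    calc ∫ u in Set.Icc (-(k : ℝ)) k, ‖u ^ n‖ ∂μ
        ≤ ∫ u in Set.Icc (-(k : ℝ)) k, cutoff k u * Q.eval u ∂μ := by
          refine setIntegral_mono_on (Continuous.continuousOn (by fun_prop)).integrableOn_Icc
            hc.continuousOn.integrableOn_Icc measurableSet_Icc fun u hu => ?_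
          rw [cutoff_eq_one (abs_le.mpr hu), one_mul, hQ, Real.norm_eq_abs, abs_le]
          constructor <;> nlinarith [sq_nonneg (u ^ n - 1), sq_nonneg (u ^ n + 1)]
      _ ≤ ∫ u, cutoff k u * Q.eval u ∂μ := by
          refine setIntegral_le_integral (hc.integrable_of_hasCompactSupport hs)
            (Filter.Eventually.of_forall fun u => ?_)
          exact mul_nonneg (cutoff_nonneg _ _) (by rw [hQ]; positivity)
      _ = L ⟨_, cc_mem_polyDom hc hs⟩ := hμ ⟨_, cc_mem_polyDom hc hs⟩ hc hs
      _ ≤ L (polyEmb Q) := by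
          refine mono _ _ fun u => ?_
          exact mul_le_of_le_one_left (by rw [hQ]; positivity) (cutoff_le_one _ _)
  refine ⟨hInteg n, ?_⟩
  let R : Polynomial ℝ := 1 + Polynomial.X ^ (2 * (n + 1))
  have hR : ∀ u, R.eval u = 1 + u ^ (2 * (n + 1)) := fun u => by simp [R]
  have hRint : Integrable (fun u => 1 + u ^ (2 * (n + 1))) μ := by
    have h0 : Integrable (fun _ : ℝ => (1 : ℝ)) μ := by simpa only [pow_zero] using hInteg 0
    exact h0.add (hInteg (2 * (n + 1)))
  set A := ∫ u, (1 + u ^ (2 * (n + 1))) ∂μ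
  set B := L (polyEmb R)
  have key : ∀ k : ℝ, 0 < k →
      |∫ u, u ^ n ∂μ - L (polyEmb (Polynomial.X ^ n))| ≤ k⁻¹ * (A + B) := by
    intro k hk
    have hc : Continuous (fun u => cutoff k u * u ^ n) :=
      (cutoff_cont k).mul (by fun_prop)
    have hs : HasCompactSupport (fun u => cutoff k u * u ^ n) := (cutoff_supp k).mul_right
    let f : polyDom := ⟨_, cc_mem_polyDom hc hs⟩
    have h1 : ∫ u, cutoff k u * u ^ n ∂μ = L f := hμ f hc hs
    have h2 : |∫ u, u ^ n ∂μ - L f| ≤ k⁻¹ * A := by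
      rw [← h1, ← integral_sub (hInteg n) (hc.integrable_of_hasCompactSupport hs),
        ← integral_const_mul, ← Real.norm_eq_abs]
      exact norm_integral_le_of_norm_le (hRint.const_mul _)
        (Filter.Eventually.of_forall fun u => tail_bound n hk u)
    have h3 : |L (polyEmb (Polynomial.X ^ n)) - L f| ≤ k⁻¹ * B := by
      have e1 : ∀ u, (polyEmb (Polynomial.X ^ n) - f).1 u = u ^ n - cutoff k u * u ^ n := by
        intro u
        change Polynomial.eval u (Polynomial.X ^ n) - _ = _
        simp [f]
      have e2 : ∀ u, (k⁻¹ • polyEmb R).1 u = k⁻¹ * (1 + u ^ (2 * (n + 1))) := by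
        intro u
        change k⁻¹ * R.eval u = _
        rw [hR]
      have a1 := mono (polyEmb (Polynomial.X ^ n) - f) (k⁻¹ • polyEmb R) (fun u => by
        rw [e1, e2]; exact (abs_le.mp (tail_bound n hk u)).2)
      have a2 := mono (-(k⁻¹ • polyEmb R)) (polyEmb (Polynomial.X ^ n) - f) (fun u => by
        have := (abs_le.mp (tail_bound n hk u)).1
        rw [← e1, ← e2] at this
        exact this)
      rw [map_neg] at a2
      rw [map_sub, map_smul, smul_eq_mul] at a1 a2
      exact abs_le.mpr ⟨a2, a1⟩
    rw [abs_le] at *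
    constructor <;> linarith [h2.1, h2.2, h3.1, h3.2]
  have hlim : Filter.Tendsto (fun k : ℝ => k⁻¹ * (A + B)) Filter.atTop (nhds 0) := by
    simpa using tendsto_inv_atTop_zero.mul_const (A + B)
  have := ge_of_tendsto hlim ((Filter.eventually_gt_atTop 0).mono key)
  exact sub_eq_zero.mp (abs_nonpos_iff.mp this)

/-- Hamburger moment problem: `(mₙ)` with `m₀ = 1` is the moment sequence of a
probability measure on `ℝ` iff `∑ xₙ mₙ ≥ 0` for every polynomial `∑ xₙ uⁿ` that is
non-negative on all of `ℝ`. -/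
theorem hamburger_moment_problem
    (m : ℕ → ℝ) (hm0 : m 0 = 1) :
    (∃ ρ : Measure ℝ, IsProbabilityMeasure ρ ∧
      (∀ n : ℕ, Integrable (fun u => u ^ n) ρ) ∧
      (∀ n : ℕ, m n = ∫ u, u ^ n ∂ρ)) ↔
    (∀ P : Polynomial ℝ, (∀ u : ℝ, 0 ≤ P.eval u) →
      0 ≤ P.sum (fun n c => c * m n)) := by
  constructor
  · rintro ⟨ρ, _, hi, hm⟩ P hP
    have : P.sum (fun n c => c * m n) = ∫ u, P.eval u ∂ρ := by
      simp only [Polynomial.eval_eq_sum, Polynomial.sum_def]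
      rw [integral_finsetSum _ (fun n _ => (hi n).const_mul _)]
      simp only [integral_const_mul, hm]
    rw [this]
    exact integral_nonneg hP
  · intro h
    obtain ⟨L, hLP, hL⟩ := exists_extension m h
    obtain ⟨μ, _, hμ⟩ := exists_measure L hL
    have hmom := moments_of_functional L hL μ hμ
    have hm : ∀ n, m n = ∫ u, u ^ n ∂μ := by
      intro n
      rw [(hmom n).2, hLP]
      change m n = (Polynomial.X ^ n : Polynomial ℝ).sum (fun n c => c * m n)
      rw [Polynomial.X_pow_eq_monomial, Polynomial.sum_monomial_index _ _ (by simp), one_mul]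
    refine ⟨μ, ?_, fun n => (hmom n).1, hm⟩
    have h0 := hm 0
    simp only [hm0, pow_zero, integral_const, smul_eq_mul, mul_one] at h0
    constructor
    rw [Measure.real, eq_comm, ENNReal.toReal_eq_one_iff] at h0
    exact h0
end

section
/- A sequence (m_n)_{n≥0} of real numbers with m₀ = 1 is the moment sequence of some Borel probability measure supported in [0, ∞) if and only if for every polynomial P = ∑ x_n u^n with P(u) ≥ 0 for all u ≥ 0, one has ∑ x_n m_n ≥ 0. -/
open MeasureTheory

open scoped CompactlySupported NNReal Topology in
/-- Abstract step: extension of the moment functional and its representation. -/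
theorem stieltjes_aux_measure (m : ℕ → ℝ)
    (h : ∀ P : Polynomial ℝ, (∀ u : ℝ, 0 ≤ u → 0 ≤ P.eval u) →
      0 ≤ P.sum (fun n c => c * m n)) :
    ∃ μ : Measure ℝ≥0, ∀ (P : Polynomial ℝ) (g : C_c(ℝ≥0, ℝ)),
      (∀ u : ℝ≥0, 0 ≤ P.eval (u : ℝ) + g u) →
        Integrable g μ ∧ 0 ≤ P.sum (fun n c => c * m n) + ∫ u, g u ∂μ := by
  let L : Polynomial ℝ →ₗ[ℝ] ℝ := Polynomial.lsum (fun n => LinearMap.mulRight ℝ (m n))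
  have hL : ∀ P, L P = P.sum (fun n c => c * m n) := fun P => rfl
  let s : PointedCone ℝ (Polynomial ℝ × C_c(ℝ≥0, ℝ)) :=
    { carrier := {x | ∀ u : ℝ≥0, 0 ≤ x.1.eval (u : ℝ) + x.2 u}
      zero_mem' := by intro u; simp
      add_mem' := by
        intro a b ha hb u
        have h1 := ha u
        have h2 := hb u
        simp only [Prod.fst_add, Prod.snd_add, Polynomial.eval_add,
          CompactlySupportedContinuousMap.add_apply]
        linarith
      smul_mem' := by
        rintro ⟨c, hc⟩ a ha u
        have h1 := mul_nonneg hc (ha u)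
        have : ((⟨c, hc⟩ : {c : ℝ // 0 ≤ c}) • a) = c • a := rfl
        rw [this]
        simp only [Prod.smul_fst, Prod.smul_snd, Polynomial.eval_smul,
          CompactlySupportedContinuousMap.smul_apply, smul_eq_mul]
        linarith }
  let f : (Polynomial ℝ × C_c(ℝ≥0, ℝ)) →ₗ.[ℝ] ℝ :=
    { domain := LinearMap.ker (LinearMap.snd ℝ (Polynomial ℝ) C_c(ℝ≥0, ℝ))
      toFun := (L ∘ₗ LinearMap.fst ℝ (Polynomial ℝ) C_c(ℝ≥0, ℝ)) ∘ₗ Submodule.subtype _ }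
  obtain ⟨G, hG1, hG2⟩ := riesz_extension s f (by
    rintro ⟨⟨P, g⟩, hx⟩ hs
    have hg : g = 0 := hx
    subst hg
    refine h P fun u hu => ?_
    have : 0 ≤ P.eval u + 0 := hs ⟨u, hu⟩
    simpa using this) (by
    rintro ⟨P, g⟩
    obtain ⟨C, hC⟩ := g.hasCompactSupport.exists_bound_of_continuous (map_continuous g)
    refine ⟨⟨(-P + Polynomial.C C, 0), rfl⟩, fun u => ?_⟩
    have h1 := hC u
    rw [Real.norm_eq_abs, abs_le] at h1
    simp
    linarith)
  have hGP : ∀ P, G (P, 0) = L P := fun P => hG1 ⟨(P, 0), rfl⟩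
  let Λ : C_c(ℝ≥0, ℝ) →ₚ[ℝ] ℝ := PositiveLinearMap.mk₀
    (G ∘ₗ LinearMap.inr ℝ (Polynomial ℝ) C_c(ℝ≥0, ℝ)) (by
      intro g hg
      refine hG2 _ fun u => ?_
      have := hg u
      simpa using this)
  have hΛ : ∀ g, Λ g = G (0, g) := fun g => rfl
  refine ⟨RealRMK.rieszMeasure Λ, fun P g hPg => ⟨g.integrable, ?_⟩⟩
  rw [RealRMK.integral_rieszMeasure, hΛ, ← hL, ← hGP, ← map_add]
  refine hG2 _ fun u => ?_
  simpa using hPg u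

open scoped NNReal CompactlySupported in
/-- A continuous cutoff function on `[0, ∞)` times `u ^ n`. -/
noncomputable def stieltjesCutoff (n k : ℕ) : C_c(ℝ≥0, ℝ) where
  toFun u := (u : ℝ) ^ n * max 0 (min 1 ((k : ℝ) + 1 - u))
  continuous_toFun := by fun_prop
  hasCompactSupport' := by
    refine HasCompactSupport.intro (isCompact_Icc (a := (0 : ℝ≥0)) (b := (k : ℝ≥0) + 1)) ?_
    intro u hu
    have h1 : (k : ℝ≥0) + 1 < u := by
      by_contra hc
      exact hu ⟨zero_le, not_lt.mp hc⟩
    have h2 : (k : ℝ) + 1 < u := by exact_mod_cast h1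
    rw [max_eq_left, mul_zero]
    exact (min_le_right _ _).trans (by linarith)

open scoped NNReal in
theorem stieltjesCutoff_apply (n k : ℕ) (u : ℝ≥0) :
    stieltjesCutoff n k u = (u : ℝ) ^ n * max 0 (min 1 ((k : ℝ) + 1 - u)) := rfl

open scoped NNReal in
theorem stieltjesCutoff_nonneg (n k : ℕ) (u : ℝ≥0) : 0 ≤ stieltjesCutoff n k u := by
  rw [stieltjesCutoff_apply]
  positivity

open scoped NNReal in
theorem stieltjesCutoff_le (n k : ℕ) (u : ℝ≥0) : stieltjesCutoff n k u ≤ (u : ℝ) ^ n := by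
  rw [stieltjesCutoff_apply]
  exact mul_le_of_le_one_right (by positivity) (max_le zero_le_one (min_le_left _ _))

open scoped NNReal in
theorem stieltjesCutoff_eq (n k : ℕ) (u : ℝ≥0) (h : (u : ℝ) ≤ k) :
    stieltjesCutoff n k u = (u : ℝ) ^ n := by
  rw [stieltjesCutoff_apply, min_eq_left (by linarith), max_eq_right zero_le_one, mul_one]

open scoped NNReal in
theorem stieltjesCutoff_tail (n k : ℕ) (u : ℝ≥0) :
    (u : ℝ) ^ n - stieltjesCutoff n (k + 1) u ≤ (u : ℝ) ^ (n + 1) * (1 / ((k : ℝ) + 1)) := by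
  rcases le_total (u : ℝ) ((k + 1 : ℕ) : ℝ) with h | h
  · rw [stieltjesCutoff_eq _ _ _ h, sub_self]
    positivity
  · have h1 := stieltjesCutoff_nonneg n (k + 1) u
    push_cast at h
    have h2 : (u : ℝ) ^ n ≤ (u : ℝ) ^ (n + 1) * (1 / ((k : ℝ) + 1)) := by
      rw [mul_one_div, le_div_iff₀ (by positivity), pow_succ]
      exact mul_le_mul_of_nonneg_left h (by positivity)
    linarith

open scoped NNReal CompactlySupported Topology in
open Filter in
theorem stieltjes_aux_moments (m : ℕ → ℝ) (μ : Measure ℝ≥0)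
    (hμ : ∀ (P : Polynomial ℝ) (g : C_c(ℝ≥0, ℝ)),
      (∀ u : ℝ≥0, 0 ≤ P.eval (u : ℝ) + g u) →
        Integrable g μ ∧ 0 ≤ P.sum (fun n c => c * m n) + ∫ u, g u ∂μ) (n : ℕ) :
    Integrable (fun u : ℝ≥0 => (u : ℝ) ^ n) μ ∧ ∫ u : ℝ≥0, (u : ℝ) ^ n ∂μ = m n := by
  have hmono : ∀ (j : ℕ) (c : ℝ), (Polynomial.monomial j c).sum (fun n c => c * m n) = c * m j :=
    fun j c => Polynomial.sum_monomial_index c (fun n c => c * m n) (zero_mul _)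
  have hInteg : ∀ k, Integrable (stieltjesCutoff n k) μ := fun k =>
    (hμ 0 (stieltjesCutoff n k) fun u => by simpa using stieltjesCutoff_nonneg n k u).1
  have hup : ∀ k, ∫ u, stieltjesCutoff n k u ∂μ ≤ m n := by
    intro k
    have := (hμ (Polynomial.monomial n 1) (-stieltjesCutoff n k) fun u => by
      have := stieltjesCutoff_le n k u
      simpa using this).2
    rw [hmono] at this
    simp only [CompactlySupportedContinuousMap.neg_apply, integral_neg] at this
    linarith
  have hlow : ∀ k : ℕ, m n ≤ ∫ u, stieltjesCutoff n (k + 1) u ∂μ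
      + m (n + 1) * (1 / ((k : ℝ) + 1)) := by
    intro k
    have := (hμ (Polynomial.monomial (n + 1) (1 / ((k : ℝ) + 1)) + Polynomial.monomial n (-1))
      (stieltjesCutoff n (k + 1)) fun u => by
      have := stieltjesCutoff_tail n k u
      simp only [Polynomial.eval_add, Polynomial.eval_monomial]
      linarith).2
    rw [Polynomial.sum_add_index _ _ _ (by simp) (by intros; ring), hmono, hmono] at this
    linarith
  have hptw : ∀ u : ℝ≥0, Tendsto (fun k => stieltjesCutoff n k u) atTop (𝓝 ((u : ℝ) ^ n)) := by
    intro u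
    obtain ⟨K, hK⟩ := exists_nat_ge (u : ℝ)
    refine tendsto_const_nhds.congr' ?_
    filter_upwards [eventually_ge_atTop K] with k hk
    exact (stieltjesCutoff_eq n k u (hK.trans (by exact_mod_cast hk))).symm
  have hI : Integrable (fun u : ℝ≥0 => (u : ℝ) ^ n) μ := by
    refine ⟨(by fun_prop : Continuous fun u : ℝ≥0 => (u : ℝ) ^ n).measurable.aestronglyMeasurable, ?_⟩
    rw [hasFiniteIntegral_iff_ofReal (Eventually.of_forall fun u => by positivity)]
    have h1 : ∀ u : ℝ≥0, ENNReal.ofReal ((u : ℝ) ^ n)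
        = liminf (fun k => ENNReal.ofReal (stieltjesCutoff n k u)) atTop := fun u =>
      (((ENNReal.continuous_ofReal.tendsto _).comp (hptw u)).liminf_eq).symm
    simp_rw [h1]
    refine (lintegral_liminf_le fun k =>
      ((map_continuous (stieltjesCutoff n k)).measurable.ennreal_ofReal)).trans_lt ?_
    refine lt_of_le_of_lt ?_ (ENNReal.ofReal_lt_top (r := m n))
    refine liminf_le_of_le (by isBoundedDefault) fun b hb => ?_
    obtain ⟨k, hk⟩ := hb.exists
    refine hk.trans ?_
    rw [← ofReal_integral_eq_lintegral_ofReal (hInteg k)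
      (Eventually.of_forall fun u => stieltjesCutoff_nonneg n k u)]
    exact ENNReal.ofReal_le_ofReal (hup k)
  refine ⟨hI, ?_⟩
  have hT : Tendsto (fun k => ∫ u, stieltjesCutoff n k u ∂μ) atTop
      (𝓝 (∫ u : ℝ≥0, (u : ℝ) ^ n ∂μ)) := by
    refine tendsto_integral_of_dominated_convergence _
      (fun k => (hInteg k).aestronglyMeasurable) hI ?_ (Eventually.of_forall hptw)
    intro k
    refine Eventually.of_forall fun u => ?_
    rw [Real.norm_eq_abs, abs_of_nonneg (stieltjesCutoff_nonneg n k u)]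
    exact stieltjesCutoff_le n k u
  refine le_antisymm (le_of_tendsto' hT hup) ?_
  have h2 := ((tendsto_add_atTop_iff_nat 1).mpr hT).add
    ((tendsto_one_div_add_atTop_nhds_zero_nat (𝕜 := ℝ)).const_mul (m (n + 1)))
  rw [mul_zero, add_zero] at h2
  exact ge_of_tendsto' h2 hlow

/-- Stieltjes moment problem: `(mₙ)` with `m₀ = 1` is the moment sequence of a
probability measure supported in `[0, ∞)` iff `∑ xₙ mₙ ≥ 0` for every polynomial
`∑ xₙ uⁿ` that is non-negative on `[0, ∞)`. -/
theorem stieltjes_moment_problem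
    (m : ℕ → ℝ) (hm0 : m 0 = 1) :
    (∃ ρ : Measure ℝ, IsProbabilityMeasure ρ ∧
      ρ (Set.Ici (0 : ℝ))ᶜ = 0 ∧
      (∀ n : ℕ, Integrable (fun u => u ^ n) ρ) ∧
      (∀ n : ℕ, m n = ∫ u, u ^ n ∂ρ)) ↔
    (∀ P : Polynomial ℝ, (∀ u : ℝ, 0 ≤ u → 0 ≤ P.eval u) →
      0 ≤ P.sum (fun n c => c * m n)) := by
  constructor
  · rintro ⟨ρ, _, hsupp, hInteg, hmom⟩ P hP
    have h1 : P.sum (fun n c => c * m n) = ∫ u, P.eval u ∂ρ := by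
      simp only [Polynomial.eval_eq_sum, Polynomial.sum_def]
      rw [integral_finsetSum _ fun i _ => (hInteg i).const_mul _]
      refine Finset.sum_congr rfl fun i _ => ?_
      rw [integral_const_mul, hmom]
    rw [h1]
    refine integral_nonneg_of_ae ?_
    have h2 : ∀ᵐ u ∂ρ, u ∈ Set.Ici (0 : ℝ) := hsupp
    filter_upwards [h2] with u hu using hP u hu
  · intro h
    obtain ⟨μ, hμ⟩ := stieltjes_aux_measure m h
    have hM := stieltjes_aux_moments m μ hμ
    have hme : Measurable (fun u : NNReal => (u : ℝ)) := measurable_coe_nnreal_real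
    have hprob : IsProbabilityMeasure μ := by
      obtain ⟨hi, he⟩ := hM 0
      simp only [pow_zero, integral_const, smul_eq_mul, mul_one, hm0] at hi he
      refine ⟨?_⟩
      have := he
      rw [measureReal_def, ENNReal.toReal_eq_one_iff] at this
      exact this
    refine ⟨μ.map (fun u : NNReal => (u : ℝ)), Measure.isProbabilityMeasure_map hme.aemeasurable,
      ?_, fun n => ?_, fun n => ?_⟩
    · rw [Measure.map_apply hme measurableSet_Ici.compl]
      convert measure_empty (μ := μ)
      ext u
      simp
    · rw [integrable_map_measure (by fun_prop) hme.aemeasurable]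
      exact (hM n).1
    · rw [integral_map hme.aemeasurable (by fun_prop)]
      exact (hM n).2.symm
end
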